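/- Let H be a cocommutative Hopf algebra over a commutative ring k, and let X = H⊗H with the tensor-product comultiplication Δ_X(x⊗y) = (x⁽¹⁾⊗y⁽¹⁾) ⊗ (x⁽²⁾⊗y⁽²⁾), the right H-action (x⊗y)·g = ad_{g⁽¹⁾}(x) ⊗ ad_{g⁽²⁾}(y), and augmentation map ν(x⊗y) = xy. The associated R-matrix R : X⊗X → X⊗X, R(w⊗z) = z⁽¹⁾ ⊗ (w·ν(z⁽²⁾)), satisfies the Yang–Baxter equation (R⊗1)∘(1⊗R)∘(R⊗1) = (1⊗R)∘(R⊗1)∘(1⊗R) on X⊗X⊗X. -/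

import Mathlib

open TensorProduct

variable (k : Type*) [CommRing k] (H : Type*) [Ring H] [HopfAlgebra k H]

/-- The adjoint action `H ⊗ H → H`, `x ⊗ g ↦ ad_g(x) = S(g⁽¹⁾) x g⁽²⁾`. -/
noncomputable def adAct : H ⊗[k] H →ₗ[k] H :=
  LinearMap.mul' k H ∘ₗ
    TensorProduct.map (HopfAlgebra.antipode (R := k)) (LinearMap.mul' k H) ∘ₗ
    (TensorProduct.leftComm k H H H).toLinearMap ∘ₗ
    LinearMap.lTensor H (Coalgebra.comul (R := k))

/-- The right `H`-action on `X = H ⊗ H`: `(x ⊗ y) · g = ad_{g⁽¹⁾}(x) ⊗ ad_{g⁽²⁾}(y)`. -/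
noncomputable def adXAct : (H ⊗[k] H) ⊗[k] H →ₗ[k] H ⊗[k] H :=
  TensorProduct.map (adAct k H) (adAct k H) ∘ₗ
    (TensorProduct.tensorTensorTensorComm k H H H H).toLinearMap ∘ₗ
    LinearMap.lTensor (H ⊗[k] H) (Coalgebra.comul (R := k))

/-- The tensor-product comultiplication on `X = H ⊗ H`:
`Δ_X(x ⊗ y) = (x⁽¹⁾ ⊗ y⁽¹⁾) ⊗ (x⁽²⁾ ⊗ y⁽²⁾)`. -/
noncomputable def comulX : H ⊗[k] H →ₗ[k] (H ⊗[k] H) ⊗[k] (H ⊗[k] H) :=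
  (TensorProduct.tensorTensorTensorComm k H H H H).toLinearMap ∘ₗ
    TensorProduct.map (Coalgebra.comul (R := k)) (Coalgebra.comul (R := k))

/-- The SD map `q(w ⊗ z) = w · ν(z)` with `ν(x ⊗ y) = xy` and the adjoint action. -/
noncomputable def adQ : (H ⊗[k] H) ⊗[k] (H ⊗[k] H) →ₗ[k] H ⊗[k] H :=
  adXAct k H ∘ₗ LinearMap.lTensor (H ⊗[k] H) (LinearMap.mul' k H)

/-- The associated R-matrix `R(w ⊗ z) = z⁽¹⁾ ⊗ q(w ⊗ z⁽²⁾)` on `X ⊗ X`, `X = H ⊗ H`. -/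
noncomputable def adR : (H ⊗[k] H) ⊗[k] (H ⊗[k] H) →ₗ[k] (H ⊗[k] H) ⊗[k] (H ⊗[k] H) :=
  LinearMap.lTensor (H ⊗[k] H) (adQ k H) ∘ₗ
    (TensorProduct.leftComm k (H ⊗[k] H) (H ⊗[k] H) (H ⊗[k] H)).toLinearMap ∘ₗ
    LinearMap.lTensor (H ⊗[k] H) (comulX k H)

/-- `R ⊗ 1` as a map on `M ⊗ (M ⊗ M)`. -/
noncomputable def rOne (M : Type*) [AddCommGroup M] [Module k M]
    (R : M ⊗[k] M →ₗ[k] M ⊗[k] M) : M ⊗[k] (M ⊗[k] M) →ₗ[k] M ⊗[k] (M ⊗[k] M) :=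
  (TensorProduct.assoc k M M M).toLinearMap ∘ₗ LinearMap.rTensor M R ∘ₗ
    (TensorProduct.assoc k M M M).symm.toLinearMap

section

open Coalgebra HopfAlgebra WithConv

variable {k H}

lemma comulX_eq_comul : comulX k H = comul (R := k) (A := H ⊗[k] H) := rfl

lemma adAct_tmul_eq_convMul (x g : H) :
    adAct k H (x ⊗ₜ g) =
      (toConv (antipode k (A := H)) * toConv (LinearMap.mulLeft k x)) g := by
  rw [(ℛ k g).convMul_apply]
  simp [adAct, ← (ℛ k g).eq, tmul_sum]

lemma adAct_tmul_eq_sum {ι : Type*} (x : H) {g : H} (r : Coalgebra.Repr k g ι) :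
    adAct k H (x ⊗ₜ g) = ∑ i ∈ r.index, antipode k (r.left i) * (x * r.right i) := by
  rw [adAct_tmul_eq_convMul, r.convMul_apply]
  rfl

lemma toConv_adAct_mk (x : H) :
    toConv (adAct k H ∘ₗ TensorProduct.mk k H H x) =
      toConv (antipode k (A := H)) * toConv (LinearMap.mulLeft k x) := by
  ext g
  exact adAct_tmul_eq_convMul x g

lemma toConv_mulLeft_convMul {C : Type*} [AddCommGroup C] [Module k C] [Coalgebra k C]
    (x : H) (f g : C →ₗ[k] H) :
    toConv (LinearMap.mulLeft k x ∘ₗ f) * toConv g =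
      toConv (LinearMap.mulLeft k x ∘ₗ (toConv f * toConv g).ofConv) := by
  ext c
  rw [(ℛ k c).convMul_apply]
  simp only [LinearMap.comp_apply]
  change _ = x * ((toConv f * toConv g) c)
  rw [(ℛ k c).convMul_apply]
  simp [Finset.mul_sum, mul_assoc]

/-- `h⁽¹⁾ ad_{h⁽²⁾}(b) = b h`. -/
lemma id_convMul_adAct (b : H) :
    toConv (LinearMap.id (R := k) (M := H)) * toConv (adAct k H ∘ₗ TensorProduct.mk k H H b) =
      toConv (LinearMap.mulLeft k b) := by
  rw [toConv_adAct_mk, ← mul_assoc, LinearMap.id_mul_antipode, one_mul]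

/-- `ad_{h⁽¹⁾}(x) ad_{h⁽²⁾}(y) = ad_h(x y)`. -/
lemma adAct_convMul_adAct (x y : H) :
    toConv (adAct k H ∘ₗ TensorProduct.mk k H H x) *
        toConv (adAct k H ∘ₗ TensorProduct.mk k H H y) =
      toConv (adAct k H ∘ₗ TensorProduct.mk k H H (x * y)) := by
  have h := toConv_mulLeft_convMul (k := k) x (LinearMap.id (R := k) (M := H))
    (adAct k H ∘ₗ TensorProduct.mk k H H y)
  rw [id_convMul_adAct, LinearMap.comp_id, ofConv_toConv, ← LinearMap.mulLeft_mul] at h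
  rw [toConv_adAct_mk x, mul_assoc, h, ← toConv_adAct_mk]

lemma adAct_tmul_mul (x g h : H) :
    adAct k H (x ⊗ₜ (g * h)) = adAct k H (adAct k H (x ⊗ₜ g) ⊗ₜ h) := by
  rw [adAct_tmul_eq_sum x ((ℛ k g).mul (ℛ k h)), adAct_tmul_eq_sum _ (ℛ k h),
    adAct_tmul_eq_sum x (ℛ k g)]
  simp only [Coalgebra.Repr.mul_index, Coalgebra.Repr.mul_left, Coalgebra.Repr.mul_right,
    antipode_mul_antidistrib, Finset.sum_mul, Finset.mul_sum]
  rw [Finset.sum_product_right]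
  simp only [mul_assoc]

lemma map_adAct_adAct_comp_tensorTensorTensorComm :
    TensorProduct.map (adAct k H) (adAct k H) ∘ₗ
        (TensorProduct.tensorTensorTensorComm k H H H H).toLinearMap = adAct k (H ⊗[k] H) := by
  ext x y g h
  simp only [TensorProduct.AlgebraTensorModule.curry_apply, TensorProduct.curry_apply,
    LinearMap.coe_restrictScalars, LinearMap.comp_apply, LinearEquiv.coe_coe,
    TensorProduct.tensorTensorTensorComm_tmul, TensorProduct.map_tmul]
  rw [adAct_tmul_eq_sum (x ⊗ₜ[k] y) ((ℛ k g).tmul (ℛ k h)), adAct_tmul_eq_sum x (ℛ k g),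
    adAct_tmul_eq_sum y (ℛ k h)]
  simp only [Coalgebra.Repr.tmul_index, Coalgebra.Repr.tmul_left, Coalgebra.Repr.tmul_right,
    TensorProduct.antipode_def, sum_tmul, tmul_sum]
  rw [Finset.sum_product_right]
  simp

lemma adXAct_tmul (w : H ⊗[k] H) (h : H) :
    adXAct k H (w ⊗ₜ h) = adAct k (H ⊗[k] H) (w ⊗ₜ comul (R := k) h) := by
  rw [← map_adAct_adAct_comp_tensorTensorTensorComm]
  rfl

lemma adXAct_tmul_mul (w : H ⊗[k] H) (g h : H) :
    adXAct k H (w ⊗ₜ (g * h)) = adXAct k H (adXAct k H (w ⊗ₜ g) ⊗ₜ h) := by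
  simp only [adXAct_tmul, Bialgebra.comul_mul, adAct_tmul_mul]

lemma mul'_adXAct_tmul (w : H ⊗[k] H) (h : H) :
    LinearMap.mul' k H (adXAct k H (w ⊗ₜ h)) = adAct k H (LinearMap.mul' k H w ⊗ₜ h) := by
  induction w with
  | zero => simp
  | add a b ha hb => simp only [add_tmul, map_add, ha, hb]
  | tmul x y =>
    have := congr($(adAct_convMul_adAct (k := k) x y) h)
    rw [(ℛ k h).convMul_apply] at this
    simpa [adXAct, ← (ℛ k h).eq, tmul_sum] using this

lemma adQ_tmul (w z : H ⊗[k] H) :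
    adQ k H (w ⊗ₜ z) = adXAct k H (w ⊗ₜ LinearMap.mul' k H z) := rfl

/-- Self-distributivity of `q`: `q(q(x ⊗ z⁽¹⁾) ⊗ q(y ⊗ z⁽²⁾)) = q(q(x ⊗ y) ⊗ z)`. -/
lemma adQ_self_distrib (x y z : H ⊗[k] H) :
    adQ k H (TensorProduct.map (adQ k H ∘ₗ TensorProduct.mk k _ _ x)
        (adQ k H ∘ₗ TensorProduct.mk k _ _ y) (comul (R := k) z)) =
      adQ k H (adQ k H (x ⊗ₜ y) ⊗ₜ z) := by
  set b := LinearMap.mul' k H y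
  have hb := congr($(id_convMul_adAct (k := k) b) (LinearMap.mul' k H z))
  have hz : comul (R := k) (LinearMap.mul' k H z) =
      TensorProduct.map (LinearMap.mul' k H) (LinearMap.mul' k H) (comul (R := k) z) :=
    (CoalgHomClass.map_comp_comul_apply (Bialgebra.mulCoalgHom k H) z).symm
  rw [LinearMap.convMul_apply, hz, ← (ℛ k z).eq] at hb
  simp only [map_sum, TensorProduct.map_tmul, LinearMap.mul'_apply,
    LinearMap.id_apply, LinearMap.comp_apply, TensorProduct.mk_apply] at hb
  rw [← (ℛ k z).eq]
  simp only [map_sum, TensorProduct.map_tmul, LinearMap.comp_apply, TensorProduct.mk_apply,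
    adQ_tmul, mul'_adXAct_tmul, ← adXAct_tmul_mul]
  rw [← map_sum, ← tmul_sum, hb]
  rfl

section Cocommutative

variable [IsCocomm k H]

variable (k H) in
/-- The antipode of a cocommutative Hopf algebra is a coalgebra homomorphism. -/
noncomputable def antipodeCoalgHom : H →ₗc[k] H where
  toLinearMap := antipode k
  counit_comp := counit_comp_antipode
  map_comp_comul := by
    apply toConv_injective
    refine left_inv_eq_right_inv (a := toConv (comul (R := k) (A := H))) ?_
      LinearMap.comul_right_inv
    have h : toConv (TensorProduct.map (antipode k (A := H)) (antipode k (A := H))) *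
        toConv (TensorProduct.map (LinearMap.id (R := k) (M := H)) LinearMap.id) = 1 := by
      have := TensorProduct.map_convMul_map (f := toConv (antipode k (A := H)))
        (g := toConv (antipode k (A := H))) (h := toConv (LinearMap.id (R := k) (M := H)))
        (k := toConv (LinearMap.id (R := k) (M := H)))
      rw [LinearMap.antipode_mul_id] at this
      refine this.trans ?_
      ext a b
      simp [Algebra.algebraMap_eq_smul_one,
        smul_tmul', Algebra.TensorProduct.one_def, smul_smul, mul_comm]
    have h2 := LinearMap.convMul_comp_coalgHom_distrib
      (toConv (TensorProduct.map (antipode k (A := H)) (antipode k (A := H))))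
      (toConv (TensorProduct.map (LinearMap.id (R := k) (M := H)) LinearMap.id))
      (comulCoalgHom k H)
    rw [h] at h2
    have h3 := congrArg toConv h2
    simp only [toConv_ofConv, TensorProduct.map_id, LinearMap.id_comp] at h3
    refine h3.symm.trans ?_
    ext a
    simp [LinearMap.convOne_def]

variable (k H) in
/-- The adjoint action of a cocommutative Hopf algebra as a coalgebra homomorphism. -/
noncomputable def adActCoalgHom : H ⊗[k] H →ₗc[k] H :=
  (Bialgebra.mulCoalgHom k H).comp <|
    (Coalgebra.TensorProduct.map (antipodeCoalgHom k H) (Bialgebra.mulCoalgHom k H)).comp <|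
    (Coalgebra.TensorProduct.assoc k k H H H).toCoalgHom.comp <|
    (Coalgebra.TensorProduct.map
      (Bialgebra.TensorProduct.comm k H H).toCoalgEquiv.toCoalgHom (.id k H)).comp <|
    (Coalgebra.TensorProduct.assoc k k H H H).symm.toCoalgHom.comp <|
    Coalgebra.TensorProduct.map (.id k H) (comulCoalgHom k H)

variable (k H) in
/-- The map `q` on `X = H ⊗ H` as a coalgebra homomorphism, for `H` cocommutative. -/
noncomputable def adQCoalgHom : (H ⊗[k] H) ⊗[k] (H ⊗[k] H) →ₗc[k] H ⊗[k] H :=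
  (adActCoalgHom k (H ⊗[k] H)).comp <|
    Coalgebra.TensorProduct.map (.id k (H ⊗[k] H))
      ((comulCoalgHom k H).comp (Bialgebra.mulCoalgHom k H))

lemma adQCoalgHom_apply (w : (H ⊗[k] H) ⊗[k] (H ⊗[k] H)) :
    adQCoalgHom k H w = adQ k H w := by
  induction w with
  | zero => simp
  | add a b ha hb => simp only [map_add, ha, hb]
  | tmul w z =>
    rw [adQ_tmul, adXAct_tmul]
    rfl

end Cocommutative

section SelfDistributive

variable {C : Type*} [AddCommGroup C] [Module k C] [Coalgebra k C]

/-- The R-matrix `w ⊗ z ↦ z⁽¹⁾ ⊗ q(w ⊗ z⁽²⁾)` of a binary operation `q` on a coalgebra. -/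
noncomputable def rMatrix (q : C ⊗[k] C →ₗ[k] C) : C ⊗[k] C →ₗ[k] C ⊗[k] C :=
  LinearMap.lTensor C q ∘ₗ (TensorProduct.leftComm k C C C).toLinearMap ∘ₗ
    LinearMap.lTensor C (comul (R := k))

lemma rMatrix_tmul {ι : Type*} (q : C ⊗[k] C →ₗ[k] C) (w : C) {z : C}
    (r : Coalgebra.Repr k z ι) :
    rMatrix q (w ⊗ₜ z) = ∑ i ∈ r.index, r.left i ⊗ₜ q (w ⊗ₜ r.right i) := by
  simp [rMatrix, ← r.eq, tmul_sum]

lemma leftComm_lTensor_comul_comul [IsCocomm k C] (z : C) :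
    TensorProduct.leftComm k C C C (LinearMap.lTensor C (comul (R := k)) (comul (R := k) z)) =
      LinearMap.lTensor C (comul (R := k)) (comul (R := k) z) := by
  have h (t : (C ⊗[k] C) ⊗[k] C) : TensorProduct.leftComm k C C C (TensorProduct.assoc k C C C t) =
      TensorProduct.assoc k C C C
        (LinearMap.rTensor C (TensorProduct.comm k C C).toLinearMap t) := by
    have : (TensorProduct.leftComm k C C C).toLinearMap ∘ₗ
          (TensorProduct.assoc k C C C).toLinearMap =
        (TensorProduct.assoc k C C C).toLinearMap ∘ₗ
          LinearMap.rTensor C (TensorProduct.comm k C C).toLinearMap := by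
      ext
      simp
    exact congr($this t)
  rw [← Coalgebra.coassoc_apply, h, ← LinearMap.comp_apply, ← LinearMap.rTensor_comp,
    IsCocomm.comm_comp_comul]

variable (q : C ⊗[k] C →ₗc[k] C)

lemma comul_coalgHom_tmul {ι : Type*} {y : C} (r : Coalgebra.Repr k y ι) (z : C) :
    comul (R := k) (q (y ⊗ₜ z)) = ∑ i ∈ r.index,
      TensorProduct.map (q.toLinearMap ∘ₗ TensorProduct.mk k C C (r.left i))
        (q.toLinearMap ∘ₗ TensorProduct.mk k C C (r.right i)) (comul (R := k) z) := by
  rw [← CoalgHomClass.map_comp_comul_apply, TensorProduct.comul_tmul, ← r.eq, ← (ℛ k z).eq]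
  simp only [sum_tmul, tmul_sum, map_sum]
  rw [Finset.sum_comm]
  simp

variable [IsCocomm k C]

lemma rMatrix_map_comul
    (hq : ∀ x y z : C, q (TensorProduct.map (q.toLinearMap ∘ₗ TensorProduct.mk k C C x)
      (q.toLinearMap ∘ₗ TensorProduct.mk k C C y) (comul (R := k) z)) = q (q (x ⊗ₜ y) ⊗ₜ z))
    {ι : Type*} (x : C) {y : C} (r : Coalgebra.Repr k y ι) (z : C) :
    rMatrix q.toLinearMap (TensorProduct.map (q.toLinearMap ∘ₗ TensorProduct.mk k C C x)
        (q.toLinearMap ∘ₗ TensorProduct.mk k C C y) (comul (R := k) z)) =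
      ∑ i ∈ r.index, TensorProduct.map (q.toLinearMap ∘ₗ TensorProduct.mk k C C (r.left i))
        (q.toLinearMap ∘ₗ TensorProduct.mk k C C (q (x ⊗ₜ r.right i))) (comul (R := k) z) := by
  have key (t : C ⊗[k] C) :
      rMatrix q.toLinearMap (TensorProduct.map (q.toLinearMap ∘ₗ TensorProduct.mk k C C x)
        (q.toLinearMap ∘ₗ TensorProduct.mk k C C y) t) =
      ∑ i ∈ r.index, TensorProduct.map (q.toLinearMap ∘ₗ TensorProduct.mk k C C (r.left i))
        (q.toLinearMap ∘ₗ TensorProduct.map (q.toLinearMap ∘ₗ TensorProduct.mk k C C x)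
          (q.toLinearMap ∘ₗ TensorProduct.mk k C C (r.right i)))
        (TensorProduct.leftComm k C C C (LinearMap.lTensor C (comul (R := k)) t)) := by
    induction t with
    | zero => simp
    | add a b ha hb => simp only [map_add, ha, hb, Finset.sum_add_distrib]
    | tmul a b =>
      simp only [rMatrix, TensorProduct.map_tmul, LinearMap.comp_apply, TensorProduct.mk_apply,
        LinearMap.lTensor_tmul, LinearEquiv.coe_coe]
      rw [show comul (R := k) (q.toLinearMap (y ⊗ₜ b)) = _ from comul_coalgHom_tmul q r b,
        ← (ℛ k b).eq]
      simp [tmul_sum]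
  rw [key, leftComm_lTensor_comul_comul]
  refine Finset.sum_congr rfl fun i _ => ?_
  rw [← LinearMap.comp_apply, LinearMap.map_comp_lTensor]
  congr 2
  ext c
  exact hq x (r.right i) c

/-- A self-distributive operation on a cocommutative coalgebra induces a solution of the
Yang–Baxter equation. -/
theorem rMatrix_yang_baxter
    (hq : ∀ x y z : C, q (TensorProduct.map (q.toLinearMap ∘ₗ TensorProduct.mk k C C x)
      (q.toLinearMap ∘ₗ TensorProduct.mk k C C y) (comul (R := k) z)) = q (q (x ⊗ₜ y) ⊗ₜ z)) :
    rOne k C (rMatrix q.toLinearMap) ∘ₗ LinearMap.lTensor C (rMatrix q.toLinearMap) ∘ₗ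
        rOne k C (rMatrix q.toLinearMap) =
      LinearMap.lTensor C (rMatrix q.toLinearMap) ∘ₗ rOne k C (rMatrix q.toLinearMap) ∘ₗ
        LinearMap.lTensor C (rMatrix q.toLinearMap) := by
  ext x y z
  let F : C ⊗[k] C →ₗ[k] C ⊗[k] C := ∑ i ∈ (ℛ k y).index,
    TensorProduct.map (q.toLinearMap ∘ₗ TensorProduct.mk k C C ((ℛ k y).left i))
      (q.toLinearMap ∘ₗ TensorProduct.mk k C C (q (x ⊗ₜ (ℛ k y).right i)))
  have hl : (rOne k C (rMatrix q.toLinearMap) ∘ₗ LinearMap.lTensor C (rMatrix q.toLinearMap) ∘ₗ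
      rOne k C (rMatrix q.toLinearMap)) (x ⊗ₜ (y ⊗ₜ z)) =
      LinearMap.lTensor C F (TensorProduct.assoc k C C C
        (LinearMap.rTensor C (comul (R := k)) (comul (R := k) z))) := by
    rw [← (ℛ k z).eq]
    simp only [rOne, LinearMap.comp_apply, LinearEquiv.coe_coe, TensorProduct.assoc_symm_tmul,
      LinearMap.rTensor_tmul, LinearMap.lTensor_tmul, rMatrix_tmul _ _ (ℛ k y),
      rMatrix_tmul _ _ (ℛ k z), map_sum,
      sum_tmul, tmul_sum, TensorProduct.assoc_tmul]
    rw [Finset.sum_comm]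
    refine Finset.sum_congr rfl fun j _ => ?_
    rw [← (ℛ k ((ℛ k z).left j)).eq]
    simp only [rMatrix_tmul _ _ (ℛ k ((ℛ k z).left j)), sum_tmul, map_sum, TensorProduct.assoc_tmul,
      LinearMap.lTensor_tmul, F, LinearMap.sum_apply, TensorProduct.map_tmul, tmul_sum,
      LinearMap.comp_apply, TensorProduct.mk_apply]
    rw [Finset.sum_comm]
    rfl
  have hr : (LinearMap.lTensor C (rMatrix q.toLinearMap) ∘ₗ rOne k C (rMatrix q.toLinearMap) ∘ₗ
      LinearMap.lTensor C (rMatrix q.toLinearMap)) (x ⊗ₜ (y ⊗ₜ z)) =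
      LinearMap.lTensor C F
        (LinearMap.lTensor C (comul (R := k)) (comul (R := k) z)) := by
    have hF (c : C) : F (comul (R := k) c) = rMatrix q.toLinearMap
        (TensorProduct.map (q.toLinearMap ∘ₗ TensorProduct.mk k C C x)
          (q.toLinearMap ∘ₗ TensorProduct.mk k C C y) (comul (R := k) c)) := by
      rw [rMatrix_map_comul q hq x (ℛ k y) c, LinearMap.sum_apply]
    have hG : rOne k C (rMatrix q.toLinearMap)
        (LinearMap.lTensor C (rMatrix q.toLinearMap) (x ⊗ₜ (y ⊗ₜ z))) =
        LinearMap.lTensor C (TensorProduct.map (q.toLinearMap ∘ₗ TensorProduct.mk k C C x)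
          (q.toLinearMap ∘ₗ TensorProduct.mk k C C y)) (TensorProduct.assoc k C C C
        (LinearMap.rTensor C (comul (R := k)) (comul (R := k) z))) := by
      rw [← (ℛ k z).eq]
      simp only [rOne, LinearMap.comp_apply, LinearEquiv.coe_coe, TensorProduct.assoc_symm_tmul,
        LinearMap.rTensor_tmul, LinearMap.lTensor_tmul, rMatrix_tmul _ _ (ℛ k z), map_sum,
        tmul_sum]
      refine Finset.sum_congr rfl fun j _ => ?_
      rw [rMatrix_tmul _ _ (ℛ k ((ℛ k z).left j)), ← (ℛ k ((ℛ k z).left j)).eq]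
      simp [sum_tmul]
    simp only [LinearMap.comp_apply] at hG ⊢
    rw [hG, Coalgebra.coassoc_apply, ← (ℛ k z).eq]
    simp [hF]
  exact hl.trans ((congrArg _ (Coalgebra.coassoc_apply z)).trans hr.symm)

end SelfDistributive

end

/-- for a cocommutative Hopf algebra `H`, the R-matrix built from the adjoint
action and `ν(x⊗y) = xy` on `X = H ⊗ H` satisfies the Yang–Baxter equation. -/
theorem adjoint_R_matrix_yang_baxter
    (hcocomm : ∀ g : H, (TensorProduct.comm k H H) (Coalgebra.comul (R := k) g) =
      Coalgebra.comul (R := k) g) :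
    rOne k (H ⊗[k] H) (adR k H) ∘ₗ LinearMap.lTensor (H ⊗[k] H) (adR k H) ∘ₗ
        rOne k (H ⊗[k] H) (adR k H) =
      LinearMap.lTensor (H ⊗[k] H) (adR k H) ∘ₗ rOne k (H ⊗[k] H) (adR k H) ∘ₗ
        LinearMap.lTensor (H ⊗[k] H) (adR k H) := by
  have : Coalgebra.IsCocomm k H := ⟨LinearMap.ext hcocomm⟩
  have hQ : (adQCoalgHom k H).toLinearMap = adQ k H := LinearMap.ext adQCoalgHom_apply
  have hR : adR k H = rMatrix (adQCoalgHom k H).toLinearMap := by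
    rw [hQ]
    rfl
  rw [hR]
  refine rMatrix_yang_baxter (adQCoalgHom k H) fun x y z => ?_
  simp only [hQ, adQCoalgHom_apply]
  exact adQ_self_distrib x y z
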